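/- Let f be strictly increasing and concave, and let all agents have matroid-rank valuations. Let I and I' be instances with the same agents N and the same positive weights such that I' is obtained from I by adding one extra good g* (each agent's valuation in I is the restriction to G of her valuation in I' on G ∪ {g*}). If A is an R^tie_f allocation of I and A' is an R^tie_f allocation of I', then v_i(A_i) ≤ v_i(A'_i) for every agent i ∈ N. (That is, the rule R^tie_f is resource-monotone.) -/

import Mathlib

open Finset

/-- `v` is a matroid-rank (binary submodular) valuation on the ground set `M`:
binary marginal gains, monotone, submodular, and normalized. -/
def MatroidRank {γ : Type} [DecidableEq γ] (M : Finset γ) (v : Finset γ → ℕ) : Prop :=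
  (∀ S ⊆ M, ∀ g ∈ M, g ∉ S → v (insert g S) = v S ∨ v (insert g S) = v S + 1) ∧
  (∀ S T : Finset γ, S ⊆ T → T ⊆ M → v S ≤ v T) ∧
  (∀ S T : Finset γ, S ⊆ T → T ⊆ M → ∀ g ∈ M, g ∉ T →
    v (insert g T) + v S ≤ v (insert g S) + v T) ∧
  v ∅ = 0

/-- An allocation of (some of) the goods in `M` to `n` agents: pairwise disjoint bundles. -/
def IsAlloc {γ : Type} (n : ℕ) (M : Finset γ) (A : Fin n → Finset γ) : Prop :=
  (∀ i, A i ⊆ M) ∧ ∀ i j : Fin n, i ≠ j → Disjoint (A i) (A j)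

/-- Non-redundancy: every agent's utility equals her bundle size. -/
def NonRedundant {γ : Type} (n : ℕ) (v : Fin n → Finset γ → ℕ) (A : Fin n → Finset γ) : Prop :=
  ∀ i, v i (A i) = (A i).card

/-- Pareto-optimality of an allocation. -/
def ParetoOptimal {γ : Type} (n : ℕ) (M : Finset γ) (v : Fin n → Finset γ → ℕ)
    (A : Fin n → Finset γ) : Prop :=
  ¬ ∃ B : Fin n → Finset γ, IsAlloc n M B ∧ (∀ i, v i (A i) ≤ v i (B i)) ∧
      ∃ i, v i (A i) < v i (B i)

/-- The edge relation of the exchange graph of allocation `A` (vertex set `M`). -/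
def ExEdge {γ : Type} [DecidableEq γ] (n : ℕ) (M : Finset γ) (v : Fin n → Finset γ → ℕ)
    (A : Fin n → Finset γ) (a b : γ) : Prop :=
  a ∈ M ∧ b ∈ M ∧ ∃ i, a ∈ A i ∧ b ∉ A i ∧ v i ((insert b (A i)).erase a) = v i (A i)

/-- `FSet M v B g` : good `g ∈ M` lies outside `B` and adds marginal value `1` to `B`. -/
def FSet {γ : Type} [DecidableEq γ] (M : Finset γ) (v : Finset γ → ℕ) (B : Finset γ)
    (g : γ) : Prop :=
  g ∈ M ∧ g ∉ B ∧ v (insert g B) = v B + 1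

/-- Path augmentation `B △ P`: for each consecutive pair `(gⱼ, gⱼ₊₁)` of the path `P`
with `gⱼ ∈ B`, remove `gⱼ` and add `gⱼ₊₁`. -/
def augmentPath {γ : Type} [DecidableEq γ] (B : Finset γ) (P : List γ) : Finset γ :=
  (B \ (((P.zip P.tail).filter fun p => p.1 ∈ B).map Prod.fst).toFinset) ∪
    (((P.zip P.tail).filter fun p => p.1 ∈ B).map Prod.snd).toFinset

/-- The weighted welfare `∑ i, wᵢ · f(vᵢ(Aᵢ))`. -/
noncomputable def Welfare {γ : Type} (n : ℕ) (w : Fin n → ℝ) (v : Fin n → Finset γ → ℕ)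
    (f : ℕ → EReal) (A : Fin n → Finset γ) : EReal :=
  ∑ i, (w i : EReal) * f (v i (A i))

/-- The set of agents receiving positive utility. -/
def PosAgents {γ : Type} (n : ℕ) (v : Fin n → Finset γ → ℕ) (A : Fin n → Finset γ) :
    Finset (Fin n) :=
  Finset.univ.filter fun i => 0 < v i (A i)

/-- The weighted welfare restricted to the positively-served agents. -/
noncomputable def RWelfare {γ : Type} (n : ℕ) (w : Fin n → ℝ) (v : Fin n → Finset γ → ℕ)
    (f : ℕ → EReal) (A : Fin n → Finset γ) : EReal :=
  ∑ i ∈ PosAgents n v A, (w i : EReal) * f (v i (A i))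

/-- `S` is lexicographically preferred to `T` (favoring lower indices), strictly. -/
def LexLt {n : ℕ} (S T : Finset (Fin n)) : Prop :=
  ∃ i, i ∈ S ∧ i ∉ T ∧ ∀ j, j < i → (j ∈ S ↔ j ∈ T)

/-- `S` is lexicographically weakly preferred to `T` (favoring lower indices). -/
def LexLE {n : ℕ} (S T : Finset (Fin n)) : Prop := S = T ∨ LexLt S T

/-- `A` is an `R_f` allocation: it maximizes the weighted welfare; if the maximum welfare
is `-∞`, it first maximizes the number of positively-served agents (breaking ties between
the sets of positively-served agents lexicographically in favor of lower indices), and then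
maximizes the weighted welfare over the positively-served agents. -/
def IsRf {γ : Type} (n : ℕ) (M : Finset γ) (w : Fin n → ℝ) (v : Fin n → Finset γ → ℕ)
    (f : ℕ → EReal) (A : Fin n → Finset γ) : Prop :=
  IsAlloc n M A ∧
  ((∃ B, IsAlloc n M B ∧ Welfare n w v f B ≠ ⊥) →
    ∀ B, IsAlloc n M B → Welfare n w v f B ≤ Welfare n w v f A) ∧
  ((∀ B, IsAlloc n M B → Welfare n w v f B = ⊥) →
    ∀ B, IsAlloc n M B →
      ((PosAgents n v B).card < (PosAgents n v A).card ∨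
        ((PosAgents n v B).card = (PosAgents n v A).card ∧
          LexLE (PosAgents n v A) (PosAgents n v B))) ∧
      (PosAgents n v B = PosAgents n v A → RWelfare n w v f B ≤ RWelfare n w v f A))

/-- Strict lexicographic order on utility vectors. -/
def VecLexLt (n : ℕ) (u u' : Fin n → ℕ) : Prop :=
  ∃ i, u i < u' i ∧ ∀ j, j < i → u j = u' j

/-- `A` is an `R^tie_f` allocation: an `R_f` allocation that is lexicographically dominating
within the set of `R_f` allocations and non-redundant. -/
def IsRfTie {γ : Type} (n : ℕ) (M : Finset γ) (w : Fin n → ℝ) (v : Fin n → Finset γ → ℕ)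
    (f : ℕ → EReal) (A : Fin n → Finset γ) : Prop :=
  IsRf n M w v f A ∧
  (∀ B, IsRf n M w v f B → ¬ VecLexLt n (fun i => v i (A i)) (fun i => v i (B i))) ∧
  NonRedundant n v A


namespace RM

section rank
variable {γ : Type} [DecidableEq γ] {M : Finset γ} {v : Finset γ → ℕ}

lemma mr_restrict {M' : Finset γ} (h : MatroidRank M' v) (hs : M ⊆ M') : MatroidRank M v := by
  obtain ⟨h1, h2, h3, h4⟩ := h
  exact ⟨fun S hS g hg => h1 S (hS.trans hs) g (hs hg), fun S T hST hT => h2 S T hST (hT.trans hs),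
    fun S T hST hT g hg => h3 S T hST (hT.trans hs) g (hs hg), h4⟩

lemma mr_insert_le (h : MatroidRank M v) {S : Finset γ} (hS : S ⊆ M) {g : γ} (hg : g ∈ M) :
    v (insert g S) ≤ v S + 1 := by
  by_cases hgS : g ∈ S
  · rw [insert_eq_of_mem hgS]; omega
  · rcases h.1 S hS g hg hgS with h | h <;> omega

lemma mr_card (h : MatroidRank M v) {S : Finset γ} (hS : S ⊆ M) : v S ≤ S.card := by
  induction S using Finset.induction_on with
  | empty => rw [h.2.2.2]; simp
  | insert g S hg ih =>
    rw [insert_subset_iff] at hS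
    have := mr_insert_le h hS.2 hS.1
    have := ih hS.2
    rw [card_insert_of_notMem hg]; omega

lemma mr_sub_aux (h : MatroidRank M v) {S Z : Finset γ} (hSZ : S ⊆ Z) (hZ : Z ⊆ M)
    {Y : Finset γ} (hY : Y ⊆ M) : v (Z ∪ Y) + v S ≤ v Z + v (S ∪ Y) := by
  induction Y using Finset.induction_on with
  | empty => simp
  | insert g Y hg ih =>
    rw [insert_subset_iff] at hY
    have ih := ih hY.2
    rw [union_insert, union_insert]
    have hs : S ∪ Y ⊆ Z ∪ Y := union_subset_union_left hSZ
    have hz : Z ∪ Y ⊆ M := union_subset hZ hY.2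
    by_cases hgZ : g ∈ Z ∪ Y
    · rw [insert_eq_of_mem hgZ]
      have := h.2.1 (S ∪ Y) (insert g (S ∪ Y)) (subset_insert _ _)
        (insert_subset hY.1 (hs.trans hz))
      omega
    · have := h.2.2.1 _ _ hs hz g hY.1 hgZ
      omega

lemma mr_sub (h : MatroidRank M v) {X Y : Finset γ} (hX : X ⊆ M) (hY : Y ⊆ M) :
    v (X ∪ Y) + v (X ∩ Y) ≤ v X + v Y := by
  have := mr_sub_aux h (inter_subset_left : X ∩ Y ⊆ X) hX hY
  rwa [union_eq_right.2 (inter_subset_right : X ∩ Y ⊆ Y)] at this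

lemma mr_indep_sub (h : MatroidRank M v) {S T : Finset γ} (hST : S ⊆ T) (hT : T ⊆ M)
    (hc : v T = T.card) : v S = S.card := by
  have h1 := mr_sub h (hST.trans hT) (sdiff_subset.trans hT : T \ S ⊆ M)
  rw [union_sdiff_of_subset hST, inter_sdiff_self, h.2.2.2] at h1
  have h2 := mr_card h (sdiff_subset.trans hT : T \ S ⊆ M)
  have h3 := card_sdiff_add_card_eq_card hST
  have h4 := mr_card h (hST.trans hT)
  omega

/-- spanning -/
lemma mr_span (h : MatroidRank M v) {I : Finset γ} (hI : I ⊆ M) {T : Finset γ} (hT : T ⊆ M)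
    (hs : ∀ t ∈ T, v (insert t I) ≤ v I) : v (I ∪ T) ≤ v I := by
  induction T using Finset.induction_on with
  | empty => simp
  | insert g T hg ih =>
    rw [insert_subset_iff] at hT
    have ih := ih hT.2 (fun t ht => hs t (mem_insert_of_mem ht))
    have h1 := hs g (mem_insert_self _ _)
    have h2 := mr_sub h (union_subset hI hT.2) (insert_subset hT.1 hI)
    have h3 : (I ∪ T) ∪ insert g I = I ∪ insert g T := by ext x; simp; tauto
    have h4 := h.2.1 I ((I ∪ T) ∩ insert g I)
      (subset_inter subset_union_left (subset_insert _ _))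
      (inter_subset_left.trans (union_subset hI hT.2))
    rw [h3] at h2
    omega

/-- swapping lemma for interior vertices -/
lemma mr_swap (h : MatroidRank M v) {I : Finset γ} (hI : I ⊆ M) (hc : v I = I.card)
    {x y z t : γ} (hx : x ∈ I) (hz : z ∈ I) (hxz : x ≠ z) (ht : t ∉ I) (hy : y ∉ I) (hyt : y ≠ t)
    (htM : t ∈ M) (hyM : y ∈ M)
    (h1 : v ((insert t I).erase z) = v I) (h2 : v ((insert t I).erase x) ≠ v I)
    (h3 : v ((insert y I).erase x) = v I) :
    v ((insert y ((insert t I).erase z)).erase x) = v I := by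
  have hxt : x ≠ t := fun e => ht (e ▸ hx)
  have hzt : z ≠ t := fun e => ht (e ▸ hz)
  have hxy : x ≠ y := fun e => hy (e ▸ hx)
  have hzy : z ≠ y := fun e => hy (e ▸ hz)
  set P := (insert y ((insert t I).erase z)).erase x with hP
  set Q := (insert t I).erase x with hQ
  have htI : insert t I ⊆ M := insert_subset htM hI
  have hPM : P ⊆ M := (erase_subset _ _).trans (insert_subset hyM ((erase_subset _ _).trans htI))
  have hQM : Q ⊆ M := (erase_subset _ _).trans htI
  have cI : 0 < I.card := card_pos.2 ⟨x, hx⟩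
  have cPz : ((insert t I).erase z).card = I.card := by
    rw [card_erase_of_mem (mem_insert_of_mem hz), card_insert_of_notMem ht]; omega
  have cP : P.card = I.card := by
    rw [hP, card_erase_of_mem, card_insert_of_notMem, cPz]
    · omega
    · simp [hyt, hy]
    · simp [hxz, hx]
  have cQ : Q.card = I.card := by
    rw [hQ, card_erase_of_mem (mem_insert_of_mem hx), card_insert_of_notMem ht]; omega
  have hint : P ∩ Q = ((insert t I).erase z).erase x := by
    ext g; simp only [hP, hQ, mem_inter, mem_erase, mem_insert]
    constructor
    · rintro ⟨⟨a, b⟩, c, d⟩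
      refine ⟨a, ?_, d⟩
      rcases b with b | b
      · subst b; rcases d with d | d
        · exact absurd d hyt
        · exact absurd d hy
      · exact b.1
    · tauto
  have vint : v (P ∩ Q) = I.card - 1 := by
    rw [hint, mr_indep_sub h (erase_subset x _) ((erase_subset _ _).trans htI) (by rw [h1, hc, cPz]),
      card_erase_of_mem (by simp [hxz, hx]), cPz]
  have hun : (insert y I).erase x ⊆ P ∪ Q := by
    intro g; simp only [hP, hQ, mem_union, mem_erase, mem_insert]; tauto
  have h5 := h.2.1 _ _ hun (union_subset hPM hQM)
  have h6 := mr_sub h hPM hQM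
  have h7 := mr_card h hQM
  have h8 := mr_card h hPM
  omega

/-- swapping lemma for the source -/
lemma mr_swap_src (h : MatroidRank M v) {I : Finset γ} (hI : I ⊆ M) (hc : v I = I.card)
    {y z t : γ} (hz : z ∈ I) (ht : t ∉ I) (hy : y ∉ I) (hyt : y ≠ t)
    (htM : t ∈ M) (hyM : y ∈ M)
    (h1 : v ((insert t I).erase z) = v I) (h2 : v (insert t I) ≠ v I + 1)
    (h3 : v (insert y I) = v I + 1) :
    v (insert y ((insert t I).erase z)) = v I + 1 := by
  have hzt : z ≠ t := fun e => ht (e ▸ hz)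
  have hzy : z ≠ y := fun e => hy (e ▸ hz)
  have htI : insert t I ⊆ M := insert_subset htM hI
  have hPM : insert y ((insert t I).erase z) ⊆ M :=
    insert_subset hyM ((erase_subset _ _).trans htI)
  have h6 := mr_sub h hPM htI
  have hint : insert y ((insert t I).erase z) ∩ insert t I = (insert t I).erase z := by
    ext g; simp only [mem_inter, mem_erase, mem_insert]
    constructor
    · rintro ⟨b | b, d⟩
      · subst b; rcases d with d | d
        · exact absurd d hyt
        · exact absurd d hy
      · exact b
    · tauto
  have hun : insert y I ⊆ insert y ((insert t I).erase z) ∪ insert t I := by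
    intro g; simp only [mem_union, mem_erase, mem_insert]; tauto
  have h5 := h.2.1 _ _ hun (union_subset hPM htI)
  have h7 := mr_insert_le h hI htM
  have h8 := mr_insert_le h ((erase_subset z _).trans htI) hyM
  rw [hint] at h6
  omega

/-- tightness at one agent -/
lemma mr_tight (h : MatroidRank M v) {I R : Finset γ} (hI : I ⊆ M) (hc : v I = I.card)
    (h1 : ∀ t ∈ M, t ∉ I → t ∉ R → v (insert t I) ≠ v I + 1)
    (h2 : ∀ g ∈ I, g ∈ R → ∀ t ∈ M, t ∉ I → t ∉ R → v ((insert t I).erase g) ≠ v I) :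
    v (M \ R) = (I \ R).card := by
  have key : ∀ t ∈ M, t ∉ I → t ∉ R → ∀ T ⊆ I ∩ R,
      v (insert t (I \ T)) + T.card ≤ I.card := by
    intro t ht htI htR T hT
    have hvt : v (insert t I) = I.card := by
      have := h.1 I hI t ht htI
      have := h1 t ht htI htR
      omega
    induction T using Finset.induction_on with
    | empty => simp [hvt]
    | insert g T hg ih =>
      rw [insert_subset_iff] at hT
      have ih := ih hT.2
      have hgI := (mem_inter.1 hT.1).1
      have hgR := (mem_inter.1 hT.1).2
      have htg : t ≠ g := fun e => htI (e ▸ hgI)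
      have cE : ((insert t I).erase g).card = I.card := by
        rw [card_erase_of_mem (mem_insert_of_mem hgI), card_insert_of_notMem htI]; omega
      have hEM : (insert t I).erase g ⊆ M := (erase_subset _ _).trans (insert_subset ht hI)
      have a1 := h2 g hgI hgR t ht htI htR
      have a2 := mr_card h hEM
      have hTM : insert t (I \ T) ⊆ M := insert_subset ht (sdiff_subset.trans hI)
      have a3 := mr_sub h hTM hEM
      have e1 : insert t (I \ T) ∩ (insert t I).erase g = insert t (I \ insert g T) := by
        ext x; simp only [mem_inter, mem_erase, mem_insert, mem_sdiff]
        by_cases hxt : x = t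
        · subst hxt; simp [htg]
        · simp [hxt]; tauto
      have e2 : insert t (I \ T) ∪ (insert t I).erase g = insert t I := by
        ext x; simp only [mem_union, mem_erase, mem_insert, mem_sdiff]
        by_cases hxg : x = g
        · subst hxg; simp [hgI, hg]
        · simp [hxg]; tauto
      rw [e1, e2] at a3
      rw [card_insert_of_notMem hg]
      omega
  have hIR : I \ R ⊆ M := sdiff_subset.trans hI
  have hcc := mr_indep_sub h (sdiff_subset : I \ R ⊆ I) hI hc
  have hle : v (I \ R ∪ M \ R) ≤ v (I \ R) := by
    refine mr_span h hIR sdiff_subset ?_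
    intro t ht
    rw [mem_sdiff] at ht
    by_cases htI : t ∈ I
    · rw [insert_eq_of_mem (mem_sdiff.2 ⟨htI, ht.2⟩)]
    · have a := key t ht.1 htI ht.2 (I ∩ R) (subset_refl _)
      rw [sdiff_inter_self_left] at a
      have := card_sdiff_add_card_inter I R
      omega
  have hs : I \ R ⊆ M \ R := sdiff_subset_sdiff hI (subset_refl _)
  rw [union_eq_right.2 hs] at hle
  have := h.2.1 _ _ hs sdiff_subset
  omega

end rank

section walks
variable {γ : Type} [DecidableEq γ] {n : ℕ} {M : Finset γ} {v : Fin n → Finset γ → ℕ}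

/-- clean allocations -/
def Clean (n : ℕ) (M : Finset γ) (v : Fin n → Finset γ → ℕ) (A : Fin n → Finset γ) : Prop :=
  IsAlloc n M A ∧ NonRedundant n v A

/-- walks in the exchange graph starting at agent `j` -/
def IsWalk (n : ℕ) (M : Finset γ) (v : Fin n → Finset γ → ℕ) (A : Fin n → Finset γ)
    (j : Fin n) (p : ℕ → γ) (m : ℕ) : Prop :=
  FSet M (v j) (A j) (p 0) ∧ ∀ i < m, ExEdge n M v A (p i) (p (i + 1))

lemma owner_unique {A : Fin n → Finset γ} (hA : IsAlloc n M A) {i j : Fin n} {g : γ}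
    (hi : g ∈ A i) (hj : g ∈ A j) : i = j := by
  by_contra hne
  exact (Finset.disjoint_left.1 (hA.2 i j hne)) hi hj

lemma augment (hv : ∀ i, MatroidRank M (v i)) (j : Fin n) (m : ℕ) :
    ∀ (A : Fin n → Finset γ) (p : ℕ → γ), Clean n M v A → IsWalk n M v A j p m →
      (∀ k, p m ∉ A k) →
      ∃ B, Clean n M v B ∧ (B j).card = (A j).card + 1 ∧ ∀ k, k ≠ j → (B k).card = (A k).card := by
  induction m using Nat.strong_induction_on with
  | _ m ih =>
  intro A p hA hp hun
  obtain ⟨hp0, hpe⟩ := hp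
  obtain ⟨hal, hnr⟩ := hA
  rcases m with _ | m
  · refine ⟨Function.update A j (insert (p 0) (A j)), ⟨⟨?_, ?_⟩, ?_⟩, ?_, ?_⟩
    · intro i
      by_cases hij : i = j
      · subst hij; simpa using insert_subset hp0.1 (hal.1 i)
      · simpa [hij] using hal.1 i
    · intro i k hik
      have := hal.2 i k hik
      by_cases hij : i = j
      · subst hij
        simp [Ne.symm hik, hun k, this]
      · by_cases hkj : k = j
        · subst hkj
          simp [hij, hun i, this]
        · simp [hij, hkj, this]
    · intro i
      by_cases hij : i = j
      · subst hij
        rw [Function.update_self, hp0.2.2, hnr i, card_insert_of_notMem hp0.2.1]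
      · simpa [hij] using hnr i
    · rw [Function.update_self, card_insert_of_notMem hp0.2.1]
    · intro k hk; simp [hk]
  · obtain ⟨hzM, htM, l, hzl, htl, hvl⟩ := hpe m (by omega)
    by_cases hF : FSet M (v j) (A j) (p (m + 1))
    · exact ih 0 (by omega) A (fun _ => p (m + 1)) ⟨hal, hnr⟩
        ⟨hF, fun i hi => absurd hi (by omega)⟩ hun
    by_cases hsc : ∃ i < m, ExEdge n M v A (p i) (p (m + 1))
    · obtain ⟨i, him, hie⟩ := hsc
      refine ih (i + 1) (by omega) A (fun s => if s ≤ i then p s else p (m + 1)) ⟨hal, hnr⟩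
        ⟨by simpa using hp0, ?_⟩ (by simpa using hun)
      intro s hs
      have hsi : s ≤ i := by omega
      by_cases hs' : s = i
      · subst hs'; simpa using hie
      · have : s + 1 ≤ i := by omega
        simpa [hsi, this] using hpe s (by omega)
    push Not at hsc
    set t := p (m + 1) with ht
    set z := p m with hz
    set A2 := Function.update A l ((insert t (A l)).erase z) with hA2
    have hA2l : A2 l = (insert t (A l)).erase z := by simp [hA2]
    have hA2k : ∀ k, k ≠ l → A2 k = A k := fun k hk => by simp [hA2, hk]
    have hzt : z ≠ t := fun e => htl (e ▸ hzl)
    have hc2 : (A2 l).card = (A l).card := by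
      rw [hA2l, card_erase_of_mem (mem_insert_of_mem hzl), card_insert_of_notMem htl]; omega
    have hcard : ∀ k, (A2 k).card = (A k).card := by
      intro k
      by_cases hk : k = l
      · subst hk; exact hc2
      · rw [hA2k k hk]
    have hsubl : A2 l ⊆ insert t (A l) := by rw [hA2l]; exact erase_subset _ _
    have hdis : ∀ k, k ≠ l → Disjoint (A2 l) (A2 k) := by
      intro k hk
      rw [hA2k k hk]
      refine Finset.disjoint_of_subset_left hsubl ?_
      rw [disjoint_insert_left]
      exact ⟨hun k, hal.2 l k hk.symm⟩
    have hclean : Clean n M v A2 := by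
      refine ⟨⟨?_, ?_⟩, ?_⟩
      · intro i
        by_cases hi : i = l
        · subst hi; exact hsubl.trans (insert_subset htM (hal.1 i))
        · rw [hA2k i hi]; exact hal.1 i
      · intro i k hik
        by_cases hi : i = l
        · subst hi; exact hdis k hik.symm
        · by_cases hk : k = l
          · subst hk; exact (hdis i hi).symm
          · rw [hA2k i hi, hA2k k hk]; exact hal.2 i k hik
      · intro i
        rw [hcard]
        by_cases hi : i = l
        · subst hi; rw [hA2l, hvl, hnr]
        · rw [hA2k i hi, hnr]
    have hpm : ∀ i ≤ m, p i ≠ t := by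
      intro i hi e
      obtain ⟨-, -, k, hk, -⟩ := hpe i (by omega)
      rw [e] at hk
      exact hun k hk
    have hw2 : IsWalk n M v A2 j p m := by
      refine ⟨?_, ?_⟩
      · by_cases hjl : j = l
        · subst hjl
          refine ⟨hp0.1, ?_, ?_⟩
          · intro hmem
            rcases mem_insert.1 (hsubl hmem) with e | e
            · exact hpm 0 (by omega) e
            · exact hp0.2.1 e
          · rw [hA2l, hvl]
            refine mr_swap_src (hv j) (hal.1 j) (hnr j) hzl htl hp0.2.1 (hpm 0 (by omega)) htM hp0.1
              hvl ?_ hp0.2.2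
            intro e
            exact hF ⟨htM, htl, e⟩
        · rw [hA2k j hjl]; exact hp0
      · intro i hi
        obtain ⟨hxM, hyM, k, hxk, hyk, hvk⟩ := hpe i (by omega)
        refine ⟨hxM, hyM, k, ?_⟩
        by_cases hkl : k = l
        · subst hkl
          have hxz : p i ≠ z := by
            intro e
            apply hsc i hi
            rw [e]
            exact ⟨hzM, htM, k, hzl, htl, hvl⟩
          have hxt : v k ((insert t (A k)).erase (p i)) ≠ v k (A k) := by
            intro e
            exact hsc i hi ⟨hxM, htM, k, hxk, htl, e⟩
          refine ⟨?_, ?_, ?_⟩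
          · rw [hA2l]; simp [hxz, hxk]
          · intro hmem
            rcases mem_insert.1 (hsubl hmem) with e | e
            · exact hpm (i + 1) (by omega) e
            · exact hyk e
          · rw [hA2l, hvl]
            exact mr_swap (hv k) (hal.1 k) (hnr k) hxk hzl hxz htl hyk (hpm (i+1) (by omega)) htM hyM
              hvl hxt hvk
        · rw [hA2k k hkl]; exact ⟨hxk, hyk, hvk⟩
    have hun2 : ∀ k, p m ∉ A2 k := by
      intro k hk
      by_cases hkl : k = l
      · subst hkl
        rw [hA2l] at hk
        exact (mem_erase.1 hk).1 rfl
      · rw [hA2k k hkl] at hk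
        exact hkl (owner_unique hal hk hzl)
    obtain ⟨B, hB, hB1, hB2⟩ := ih m (by omega) A2 p hclean hw2 hun2
    exact ⟨B, hB, by rw [hB1, hcard], fun k hk => by rw [hB2 k hk, hcard]⟩

/-- removing one good from a bundle -/
lemma clean_erase (hv : ∀ i, MatroidRank M (v i)) {A : Fin n → Finset γ} (hA : Clean n M v A)
    (k : Fin n) (g : γ) : Clean n M v (Function.update A k ((A k).erase g)) := by
  obtain ⟨hal, hnr⟩ := hA
  have hsub : ∀ i, Function.update A k ((A k).erase g) i ⊆ A i := by
    intro i
    by_cases hi : i = k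
    · subst hi; simpa using erase_subset _ _
    · simp [hi]
  refine ⟨⟨fun i => (hsub i).trans (hal.1 i), fun i l hil => ?_⟩, fun i => ?_⟩
  · exact Finset.disjoint_of_subset_left (hsub i)
      (Finset.disjoint_of_subset_right (hsub l) (hal.2 i l hil))
  · exact mr_indep_sub (hv i) (hsub i) (hal.1 i) (hnr i)

lemma exchange (hv : ∀ i, MatroidRank M (v i)) {j k : Fin n} (hjk : j ≠ k)
    {A : Fin n → Finset γ} {p : ℕ → γ} {m : ℕ} (hA : Clean n M v A) (hp : IsWalk n M v A j p m)
    (hk : p m ∈ A k) :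
    ∃ B, Clean n M v B ∧ (B j).card = (A j).card + 1 ∧ (B k).card + 1 = (A k).card ∧
      ∀ l, l ≠ j → l ≠ k → (B l).card = (A l).card := by
  classical
  obtain ⟨m0, hm0, hmin⟩ : ∃ m0, (m0 ≤ m ∧ p m0 = p m) ∧ ∀ i < m0, p i ≠ p m := by
    have hex : ∃ i, p i = p m := ⟨m, rfl⟩
    exact ⟨Nat.find hex, ⟨Nat.find_le rfl, Nat.find_spec hex⟩, fun i hi => Nat.find_min hex hi⟩
  set g := p m with hg
  set A2 := Function.update A k ((A k).erase g) with hA2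
  have hA2k : A2 k = (A k).erase g := by simp [hA2]
  have hA2l : ∀ l, l ≠ k → A2 l = A l := fun l hl => by simp [hA2, hl]
  have hcl : Clean n M v A2 := clean_erase hv hA k g
  obtain ⟨hal, hnr⟩ := hA
  have hck : (A2 k).card + 1 = (A k).card := by rw [hA2k]; exact card_erase_add_one hk
  have hw : IsWalk n M v A2 j p m0 := by
    refine ⟨by rw [hA2l j hjk]; exact hp.1, ?_⟩
    intro i hi
    obtain ⟨hxM, hyM, l, hxl, hyl, hvl⟩ := hp.2 i (by omega)
    refine ⟨hxM, hyM, l, ?_⟩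
    by_cases hlk : l = k
    · subst hlk
      have hxg := hmin i hi
      have hc1 : ((insert (p (i+1)) (A l)).erase (p i)).card = (A l).card := by
        rw [card_erase_of_mem (mem_insert_of_mem hxl), card_insert_of_notMem hyl]; omega
      have hyg : p (i+1) ≠ g := fun e => hyl (e ▸ hk)
      refine ⟨by rw [hA2k]; simp [hxg, hxl], by rw [hA2k]; simp [hyl], ?_⟩
      have hs : (insert (p (i+1)) (A2 l)).erase (p i) ⊆ (insert (p (i+1)) (A l)).erase (p i) := by
        rw [hA2k]; exact erase_subset_erase _ (insert_subset_insert _ (erase_subset _ _))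
      rw [mr_indep_sub (hv l) hs
        ((erase_subset _ _).trans (insert_subset hyM (hal.1 l))) (by rw [hvl, hc1, hnr]),
        hcl.2 l, card_erase_of_mem, card_insert_of_notMem]
      · omega
      · rw [hA2k]; simp [hyl]
      · rw [hA2k]; simp [hxg, hxl]
    · rw [hA2l l hlk]; exact ⟨hxl, hyl, hvl⟩
  obtain ⟨B, hB, hB1, hB2⟩ := augment hv j m0 A2 p hcl hw (by
    intro l hl
    rw [hm0.2] at hl
    by_cases hlk : l = k
    · subst hlk; rw [hA2k] at hl; simp at hl
    · rw [hA2l l hlk] at hl; exact hlk (owner_unique hal hl hk))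
  refine ⟨B, hB, by rw [hB1, hA2l j hjk], by rw [hB2 k hjk.symm, hck], fun l hl hlk => ?_⟩
  rw [hB2 l hl, hA2l l hlk]

/-- reachability -/
def Reach (n : ℕ) (M : Finset γ) (v : Fin n → Finset γ → ℕ) (A : Fin n → Finset γ)
    (j : Fin n) (g : γ) : Prop := ∃ p m, IsWalk n M v A j p m ∧ p m = g

lemma Reach.start {A : Fin n → Finset γ} {j : Fin n} {g : γ} (h : FSet M (v j) (A j) g) :
    Reach n M v A j g := ⟨fun _ => g, 0, ⟨h, fun i hi => absurd hi (by omega)⟩, rfl⟩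

lemma Reach.step {A : Fin n → Finset γ} {j : Fin n} {g h : γ} (hr : Reach n M v A j g)
    (he : ExEdge n M v A g h) : Reach n M v A j h := by
  obtain ⟨p, m, hp, rfl⟩ := hr
  refine ⟨fun s => if s ≤ m then p s else h, m + 1, ⟨by simpa using hp.1, ?_⟩, by simp⟩
  intro s hs
  by_cases hs' : s = m
  · subst hs'; simpa using he
  · have h1 : s + 1 ≤ m := by omega
    have h2 : s ≤ m := by omega
    simpa [h1, h2] using hp.2 s (by omega)

/-- in a clean allocation an augmenting good can also be exchanged in -/
lemma edge_of_FSet (hv : ∀ i, MatroidRank M (v i)) {A : Fin n → Finset γ} (hA : Clean n M v A)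
    {k : Fin n} {g h : γ} (hg : g ∈ A k) (hf : FSet M (v k) (A k) h) : ExEdge n M v A g h := by
  obtain ⟨hM, hn, hval⟩ := hf
  refine ⟨hA.1.1 k hg, hM, k, hg, hn, ?_⟩
  rw [mr_indep_sub (hv k) (erase_subset _ _) (insert_subset hM (hA.1.1 k))
    (by rw [hval, hA.2 k, card_insert_of_notMem hn]),
    card_erase_of_mem (mem_insert_of_mem hg), card_insert_of_notMem hn, hA.2 k]
  omega

lemma reach_trans (hv : ∀ i, MatroidRank M (v i)) {A : Fin n → Finset γ} (hA : Clean n M v A)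
    {j k : Fin n} {g h : γ} (hr : Reach n M v A j g) (hg : g ∈ A k) (hr' : Reach n M v A k h) :
    Reach n M v A j h := by
  obtain ⟨p, m, hp, rfl⟩ := hr'
  induction m with
  | zero => exact hr.step (edge_of_FSet hv hA hg hp.1)
  | succ m ih => exact (ih ⟨hp.1, fun i hi => hp.2 i (by omega)⟩).step (hp.2 m (by omega))

lemma reach_mem {A : Fin n → Finset γ} {j : Fin n} {g : γ} (hr : Reach n M v A j g) : g ∈ M := by
  obtain ⟨p, m, hp, rfl⟩ := hr
  rcases m with _ | m
  · exact hp.1.1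
  · exact (hp.2 m (by omega)).2.1

/-- tight pairs -/
lemma tight (hv : ∀ i, MatroidRank M (v i)) {A : Fin n → Finset γ} (hA : Clean n M v A)
    {R : Finset γ} {F : Finset (Fin n)}
    (h1 : ∀ k ∈ F, ∀ h, FSet M (v k) (A k) h → h ∈ R)
    (h2 : ∀ g ∈ R, ∀ h, ExEdge n M v A g h → h ∈ R) :
    ∀ k ∈ F, v k (M \ R) = (A k \ R).card := by
  intro k hk
  refine mr_tight (hv k) (hA.1.1 k) (hA.2 k) ?_ ?_
  · intro t htM htA htR e
    exact htR (h1 k hk t ⟨htM, htA, e⟩)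
  · intro g hg hgR t htM htA htR e
    exact htR (h2 g hgR t ⟨hA.1.1 k hg, htM, k, hg, htA, e⟩)

/-- value of a tight pair -/
lemma tight_sum {A : Fin n → Finset γ} (hA : Clean n M v A)
    {R : Finset γ} {F : Finset (Fin n)} (hR : ∀ g ∈ R, ∃ k ∈ F, g ∈ A k)
    (ht : ∀ k ∈ F, v k (M \ R) = (A k \ R).card) :
    ∑ k ∈ F, (A k).card = R.card + ∑ k ∈ F, v k (M \ R) := by
  have e : R = F.biUnion (fun k => A k ∩ R) := by
    ext g; simp only [mem_biUnion, mem_inter]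
    constructor
    · intro hg; obtain ⟨k, hk, hgk⟩ := hR g hg; exact ⟨k, hk, hgk, hg⟩
    · rintro ⟨k, hk, hgk, hg⟩; exact hg
  have c : R.card = ∑ k ∈ F, (A k ∩ R).card := by
    conv_lhs => rw [e]
    refine card_biUnion ?_
    intro i _ j _ hij
    exact Finset.disjoint_of_subset_left inter_subset_left
      (Finset.disjoint_of_subset_right inter_subset_left (hA.1.2 i j hij))
  rw [c, ← sum_add_distrib]
  refine sum_congr rfl ?_
  intro k hk
  rw [ht k hk, add_comm, card_sdiff_add_card_inter]

/-- weak duality -/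
lemma weak_dual (hv : ∀ i, MatroidRank M (v i)) {A : Fin n → Finset γ} (hA : Clean n M v A)
    (R : Finset γ) (F : Finset (Fin n)) :
    ∑ k ∈ F, (A k).card ≤ R.card + ∑ k ∈ F, v k (M \ R) := by
  have c : ∑ k ∈ F, (A k ∩ R).card ≤ R.card := by
    rw [← card_biUnion]
    · refine card_le_card ?_
      intro g; simp only [mem_biUnion, mem_inter]
      rintro ⟨k, hk, hgk, hg⟩; exact hg
    · intro i _ j _ hij
      exact Finset.disjoint_of_subset_left inter_subset_left
        (Finset.disjoint_of_subset_right inter_subset_left (hA.1.2 i j hij))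
  have d : ∑ k ∈ F, (A k).card = ∑ k ∈ F, (A k ∩ R).card + ∑ k ∈ F, (A k \ R).card := by
    rw [← sum_add_distrib]
    refine sum_congr rfl fun k _ => ?_
    rw [add_comm, card_sdiff_add_card_inter]
  have e : ∑ k ∈ F, (A k \ R).card ≤ ∑ k ∈ F, v k (M \ R) := by
    refine sum_le_sum fun k _ => ?_
    rw [← mr_indep_sub (hv k) (sdiff_subset : A k \ R ⊆ A k) (hA.1.1 k) (hA.2 k)]
    exact (hv k).2.1 _ _ (sdiff_subset_sdiff (hA.1.1 k) (subset_refl _)) sdiff_subset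
  omega

/-- The simultaneous exchange property. -/
lemma sim_exchange {gs : γ} (hgs : gs ∉ M) (hv' : ∀ i, MatroidRank (insert gs M) (v i))
    {A A' : Fin n → Finset γ} (hA : Clean n M v A) (hA' : Clean n (insert gs M) v A')
    {j : Fin n} (hj : (A' j).card < (A j).card) :
    (∃ B', Clean n (insert gs M) v B' ∧ (B' j).card = (A' j).card + 1 ∧
      ∀ l, l ≠ j → (B' l).card = (A' l).card) ∨
    ∃ k, k ≠ j ∧ (A k).card < (A' k).card ∧
      (∃ B', Clean n (insert gs M) v B' ∧ (B' j).card = (A' j).card + 1 ∧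
        (B' k).card + 1 = (A' k).card ∧ ∀ l, l ≠ j → l ≠ k → (B' l).card = (A' l).card) ∧
      (∃ B, Clean n M v B ∧ (B k).card = (A k).card + 1 ∧
        (B j).card + 1 = (A j).card ∧ ∀ l, l ≠ k → l ≠ j → (B l).card = (A l).card) := by
  classical
  have hv : ∀ i, MatroidRank M (v i) := fun i => mr_restrict (hv' i) (subset_insert _ _)
  set M' := insert gs M with hM'
  by_cases hun : ∃ g, Reach n M' v A' j g ∧ ∀ k, g ∉ A' k
  · left
    obtain ⟨g, ⟨p, m, hp, rfl⟩, hg⟩ := hun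
    exact augment hv' j m A' p hA' hp hg
  right
  push Not at hun
  set R := M'.filter (Reach n M' v A' j) with hR
  have hRmem : ∀ g, g ∈ R ↔ Reach n M' v A' j g := by
    intro g; rw [hR, mem_filter]; exact ⟨fun h => h.2, fun h => ⟨reach_mem h, h⟩⟩
  set D := Finset.univ.filter (fun k => k = j ∨ ∃ g ∈ A' k, g ∈ R) with hD
  have hDmem : ∀ k, k ∈ D ↔ (k = j ∨ ∃ g ∈ A' k, g ∈ R) := by intro k; simp [hD]
  have hRown : ∀ g ∈ R, ∃ k ∈ D, g ∈ A' k := by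
    intro g hg
    obtain ⟨k, hk⟩ := hun g ((hRmem g).1 hg)
    exact ⟨k, (hDmem k).2 (Or.inr ⟨g, hk, hg⟩), hk⟩
  have hDt := tight hv' hA' (R := R) (F := D) (by
    intro k hk h hf
    rw [hRmem]
    rcases (hDmem k).1 hk with rfl | ⟨g, hg, hgR⟩
    · exact Reach.start hf
    · exact ((hRmem g).1 hgR).step (edge_of_FSet hv' hA' hg hf)) (by
    intro g hg h he
    rw [hRmem] at hg ⊢
    exact hg.step he)
  have hDs := tight_sum hA' hRown hDt
  -- the other side
  set F := Finset.univ.filter (fun k => k ≠ j ∧ ∀ g, Reach n M v A k g → ∃ l, l ≠ j ∧ g ∈ A l) with hF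
  have hFmem : ∀ k, k ∈ F ↔ (k ≠ j ∧ ∀ g, Reach n M v A k g → ∃ l, l ≠ j ∧ g ∈ A l) := by
    intro k; simp [hF]
  set S := M.filter (fun g => ∃ k ∈ F, Reach n M v A k g) with hS
  have hSmem : ∀ g, g ∈ S ↔ ∃ k ∈ F, Reach n M v A k g := by
    intro g; rw [hS, mem_filter]
    exact ⟨fun h => h.2, fun h => ⟨by obtain ⟨k, _, h⟩ := h; exact reach_mem h, h⟩⟩
  have hSown : ∀ g ∈ S, ∃ k ∈ F, g ∈ A k := by
    intro g hg
    obtain ⟨k, hk, hr⟩ := (hSmem g).1 hg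
    obtain ⟨l, hlj, hgl⟩ := ((hFmem k).1 hk).2 g hr
    refine ⟨l, (hFmem l).2 ⟨hlj, fun h hh => ?_⟩, hgl⟩
    exact ((hFmem k).1 hk).2 h (reach_trans hv hA hr hgl hh)
  have hFt := tight hv hA (R := S) (F := F) (by
    intro k hk h hf
    exact (hSmem h).2 ⟨k, hk, Reach.start hf⟩) (by
    intro g hg h he
    obtain ⟨k, hk, hr⟩ := (hSmem g).1 hg
    exact (hSmem h).2 ⟨k, hk, hr.step he⟩)
  have hFs := tight_sum hA hSown hFt
  have hjF : j ∉ F := fun h => ((hFmem j).1 h).1 rfl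
  have hjD : j ∈ D := (hDmem j).2 (Or.inl rfl)
  -- find k
  obtain ⟨k, hkD, hkF, hkj, hlt⟩ : ∃ k ∈ D, k ∉ F ∧ k ≠ j ∧ (A k).card < (A' k).card := by
    by_contra hcon
    push Not at hcon
    have b1 := weak_dual hv hA (S ∪ R.erase gs) (F ∪ D)
    have b2 := weak_dual hv' hA' (insert gs S ∩ R) (F ∩ D)
    have hSM : S ⊆ M := filter_subset _ _
    have hRM : R ⊆ M' := filter_subset _ _
    have hgS : gs ∉ S := fun h => hgs (hSM h)
    have cards : (S ∪ R.erase gs).card + (insert gs S ∩ R).card ≤ S.card + R.card := by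
      by_cases hgR : gs ∈ R
      · have e1 : insert gs S ∩ R = insert gs (S ∩ R.erase gs) := by
          ext x; by_cases hx : x = gs
          · subst hx; simp [hgR]
          · simp [hx]
        rw [e1, card_insert_of_notMem (by simp)]
        have := card_union_add_card_inter S (R.erase gs)
        have := card_erase_add_one hgR
        omega
      · have e1 : insert gs S ∩ R = S ∩ R.erase gs := by
          ext x; by_cases hx : x = gs
          · subst hx; simp [hgR]
          · simp [hx]
        rw [e1]
        have := card_union_add_card_inter S (R.erase gs)
        rw [erase_eq_of_notMem hgR] at *
        omega
    have e1 : M \ (S ∪ R.erase gs) = (M \ S) ∩ (M' \ R) := by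
      ext x
      have : x ∈ M → x ≠ gs := fun h e => hgs (e ▸ h)
      simp only [hM', mem_sdiff, mem_union, mem_erase, mem_inter, mem_insert]
      tauto
    have e2 : M' \ (insert gs S ∩ R) = (M \ S) ∪ (M' \ R) := by
      ext x
      have : x ∈ M → x ≠ gs := fun h e => hgs (e ▸ h)
      simp only [hM', mem_sdiff, mem_union, mem_inter, mem_insert]
      tauto
    rw [e1] at b1
    rw [e2] at b2
    have sMS : M \ S ⊆ M' := sdiff_subset.trans (subset_insert _ _)
    have sMR : M' \ R ⊆ M' := sdiff_subset
    have s1 : ∑ k ∈ F ∪ D, v k ((M \ S) ∩ (M' \ R)) + ∑ k ∈ F ∩ D, v k ((M \ S) ∪ (M' \ R))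
        ≤ ∑ k ∈ F, v k (M \ S) + ∑ k ∈ D, v k (M' \ R) := by
      have t1 : ∑ k ∈ F ∪ D, v k ((M \ S) ∩ (M' \ R)) =
          ∑ k ∈ F \ D, v k ((M \ S) ∩ (M' \ R)) + ∑ k ∈ D \ F, v k ((M \ S) ∩ (M' \ R)) +
            ∑ k ∈ F ∩ D, v k ((M \ S) ∩ (M' \ R)) := by
        rw [← sum_sdiff (subset_union_left : F ⊆ F ∪ D), union_sdiff_left,
          ← sum_sdiff (inter_subset_left : F ∩ D ⊆ F), sdiff_inter_self_left]
        omega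
      have t2 : ∑ k ∈ F, v k (M \ S) = ∑ k ∈ F \ D, v k (M \ S) + ∑ k ∈ F ∩ D, v k (M \ S) := by
        rw [← sum_sdiff (inter_subset_left : F ∩ D ⊆ F), sdiff_inter_self_left]
      have t3 : ∑ k ∈ D, v k (M' \ R) = ∑ k ∈ D \ F, v k (M' \ R) + ∑ k ∈ F ∩ D, v k (M' \ R) := by
        rw [← sum_sdiff (inter_subset_right : F ∩ D ⊆ D), sdiff_inter_self_right]
      have t4 : ∑ k ∈ F \ D, v k ((M \ S) ∩ (M' \ R)) ≤ ∑ k ∈ F \ D, v k (M \ S) :=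
        sum_le_sum fun k _ => (hv' k).2.1 _ _ inter_subset_left sMS
      have t5 : ∑ k ∈ D \ F, v k ((M \ S) ∩ (M' \ R)) ≤ ∑ k ∈ D \ F, v k (M' \ R) :=
        sum_le_sum fun k _ => (hv' k).2.1 _ _ inter_subset_right sMR
      have t6 : ∑ k ∈ F ∩ D, v k ((M \ S) ∩ (M' \ R)) + ∑ k ∈ F ∩ D, v k ((M \ S) ∪ (M' \ R))
          ≤ ∑ k ∈ F ∩ D, v k (M \ S) + ∑ k ∈ F ∩ D, v k (M' \ R) := by
        rw [← sum_add_distrib, ← sum_add_distrib]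
        refine sum_le_sum fun k _ => ?_
        have := mr_sub (hv' k) sMS sMR
        omega
      omega
    have u1 : ∑ k ∈ F ∪ D, (A k).card = ∑ k ∈ D \ F, (A k).card + ∑ k ∈ F, (A k).card := by
      rw [← sum_sdiff (subset_union_left : F ⊆ F ∪ D), union_sdiff_left]
    have u2 : ∑ k ∈ D, (A' k).card = ∑ k ∈ D \ F, (A' k).card + ∑ k ∈ F ∩ D, (A' k).card := by
      rw [← sum_sdiff (inter_subset_right : F ∩ D ⊆ D), sdiff_inter_self_right]
    have u3 : ∑ k ∈ D \ F, (A' k).card < ∑ k ∈ D \ F, (A k).card := by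
      refine sum_lt_sum ?_ ⟨j, mem_sdiff.2 ⟨hjD, hjF⟩, hj⟩
      intro k hk
      rw [mem_sdiff] at hk
      by_cases hkj : k = j
      · subst hkj; exact hj.le
      · exact hcon k hk.1 hk.2 hkj
    omega
  refine ⟨k, hkj, hlt, ?_, ?_⟩
  · rcases (hDmem k).1 hkD with h | ⟨g, hg, hgR⟩
    · exact absurd h hkj
    · obtain ⟨p, m, hp, rfl⟩ := (hRmem g).1 hgR
      exact exchange hv' hkj.symm hA' hp hg
  · have : ∃ g, Reach n M v A k g ∧ ∀ l, l ≠ j → g ∉ A l := by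
      by_contra hc
      push Not at hc
      exact hkF ((hFmem k).2 ⟨hkj, hc⟩)
    obtain ⟨g, ⟨p, m, hp, rfl⟩, hg⟩ := this
    by_cases hgj : p m ∈ A j
    · exact exchange hv hkj hA hp hgj
    · obtain ⟨B, hB, hB1, hB2⟩ := augment hv k m A p hA hp (by
        intro l
        by_cases hl : l = j
        · subst hl; exact hgj
        · exact hg l hl)
      have hBj : (B j).card = (A j).card := hB2 j hkj.symm
      obtain ⟨x, hx⟩ : (B j).Nonempty := by rw [← card_pos]; omega
      refine ⟨_, clean_erase hv hB j x, ?_, ?_, ?_⟩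
      · simp [hkj, hB1]
      · simp only [Function.update_self]
        rw [card_erase_add_one hx, hBj]
      · intro l hlk hlj
        simp [hlj, hB2 l hlk]

end walks

section welfare
variable {γ : Type} {n : ℕ} {M : Finset γ} {v : Fin n → Finset γ → ℕ}
  {w : Fin n → ℝ} {f : ℕ → EReal}

lemma f_fin (hf : StrictMono f) {k : ℕ} (hk : 0 < k) : f k ≠ ⊥ :=
  ((bot_le).trans_lt (hf hk)).ne'

lemma f_fin_iff (hf : StrictMono f) (h0 : f 0 = ⊥) (k : ℕ) : f k ≠ ⊥ ↔ 0 < k := by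
  constructor
  · intro h
    rcases Nat.eq_zero_or_pos k with rfl | hk
    · exact absurd h0 h
    · exact hk
  · exact f_fin hf

lemma f_fin_of (hf : StrictMono f) (h0 : f 0 ≠ ⊥) (k : ℕ) : f k ≠ ⊥ := by
  rcases Nat.eq_zero_or_pos k with rfl | hk
  · exact h0
  · exact f_fin hf hk

lemma sum_coe (hftop : ∀ k, f k ≠ ⊤) (S : Finset (Fin n)) (u : Fin n → ℕ)
    (h : ∀ i ∈ S, f (u i) ≠ ⊥) :
    ∑ i ∈ S, (w i : EReal) * f (u i) = ((∑ i ∈ S, w i * (f (u i)).toReal : ℝ) : EReal) := by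
  classical
  induction S using Finset.induction_on with
  | empty => simp
  | insert i S hi ih =>
    rw [sum_insert hi, sum_insert hi, ih (fun k hk => h k (mem_insert_of_mem hk)), EReal.coe_add,
      EReal.coe_mul, EReal.coe_toReal (hftop _) (h i (mem_insert_self _ _))]

lemma sum_bot (hw : ∀ i, 0 < w i) (u : Fin n → ℕ) (i : Fin n) (h : f (u i) = ⊥) :
    ∑ i, (w i : EReal) * f (u i) = ⊥ := by
  classical
  rw [← add_sum_erase _ _ (mem_univ i), h, EReal.coe_mul_bot_of_pos (hw i), EReal.bot_add]

lemma welfare_ne_bot (hw : ∀ i, 0 < w i) (hftop : ∀ k, f k ≠ ⊤) (B : Fin n → Finset γ) :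
    Welfare n w v f B ≠ ⊥ ↔ ∀ i, f (v i (B i)) ≠ ⊥ := by
  constructor
  · intro h i hi
    exact h (sum_bot hw (fun i => v i (B i)) i hi)
  · intro h
    rw [Welfare, sum_coe hftop univ (fun i => v i (B i)) (fun i _ => h i)]
    exact EReal.coe_ne_bot _

lemma opt_pos (hw : ∀ i, 0 < w i) (hf : StrictMono f) (hftop : ∀ k, f k ≠ ⊤) (h0 : f 0 = ⊥)
    {A B : Fin n → Finset γ} (hA : IsRf n M w v f A) (hB : IsAlloc n M B) :
    (PosAgents n v B).card < (PosAgents n v A).card ∨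
        ((PosAgents n v B).card = (PosAgents n v A).card ∧
          LexLE (PosAgents n v A) (PosAgents n v B)) := by
  by_cases hc : ∃ B, IsAlloc n M B ∧ Welfare n w v f B ≠ ⊥
  · have hWA : Welfare n w v f A ≠ ⊥ := by
      obtain ⟨C, hC, hC'⟩ := hc
      intro e
      have := hA.2.1 ⟨C, hC, hC'⟩ C hC
      rw [e, le_bot_iff] at this
      exact hC' this
    have hu : PosAgents n v A = univ := by
      ext i
      simp only [PosAgents, mem_filter, mem_univ, true_and, iff_true]
      exact (f_fin_iff hf h0 _).1 ((welfare_ne_bot hw hftop A).1 hWA i)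
    rw [hu]
    rcases (card_le_card (subset_univ (PosAgents n v B))).lt_or_eq with h | h
    · exact Or.inl h
    · exact Or.inr ⟨h, Or.inl ((card_eq_iff_eq_univ _).1 (by simpa using h)).symm⟩
  · push Not at hc
    exact (hA.2.2 hc B hB).1

lemma opt_core (hw : ∀ i, 0 < w i) (hf : StrictMono f) (hftop : ∀ k, f k ≠ ⊤)
    {A B : Fin n → Finset γ} (hA : IsRf n M w v f A) (hB : IsAlloc n M B)
    (hfin : ∀ i, f (v i (A i)) ≠ ⊥ ↔ f (v i (B i)) ≠ ⊥) (S : Finset (Fin n))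
    (hS : ∀ i, i ∈ S ↔ f (v i (A i)) ≠ ⊥) :
    ∑ i ∈ S, w i * (f (v i (B i))).toReal ≤ ∑ i ∈ S, w i * (f (v i (A i))).toReal ∧
    (∑ i ∈ S, w i * (f (v i (B i))).toReal = ∑ i ∈ S, w i * (f (v i (A i))).toReal →
      IsRf n M w v f B) := by
  have eA := sum_coe (w := w) hftop S (fun i => v i (A i)) (fun i hi => (hS i).1 hi)
  have eB := sum_coe (w := w) hftop S (fun i => v i (B i)) (fun i hi => (hfin i).1 ((hS i).1 hi))
  by_cases hc : ∃ B, IsAlloc n M B ∧ Welfare n w v f B ≠ ⊥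
  · have hWA : Welfare n w v f A ≠ ⊥ := by
      obtain ⟨C, hC, hC'⟩ := hc
      intro e
      have := hA.2.1 ⟨C, hC, hC'⟩ C hC
      rw [e, le_bot_iff] at this
      exact hC' this
    have hu : S = univ := by
      ext i
      simp only [mem_univ, iff_true]
      exact (hS i).2 ((welfare_ne_bot hw hftop A).1 hWA i)
    subst hu
    have hle := hA.2.1 hc B hB
    have eA' : Welfare n w v f A = _ := eA
    have eB' : Welfare n w v f B = _ := eB
    refine ⟨?_, fun heq => ⟨hB, fun hc C hC => ?_, fun hn => ?_⟩⟩
    · rw [eA', eB'] at hle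
      exact EReal.coe_le_coe_iff.1 hle
    · rw [eB', heq, ← eA']
      exact hA.2.1 hc C hC
    · obtain ⟨C, hC, hC'⟩ := hc
      exact absurd (hn C hC) hC'
  · push Not at hc
    have h0 : f 0 = ⊥ := by
      by_contra h
      exact (welfare_ne_bot (v := v) hw hftop A).2 (fun i => f_fin_of hf h _) (hc A hA.1)
    have hSA : PosAgents n v A = S := by
      ext i
      rw [hS, f_fin_iff hf h0]; simp [PosAgents]
    have hSB : PosAgents n v B = S := by
      ext i
      rw [hS, hfin, f_fin_iff hf h0]; simp [PosAgents]
    have eA' : RWelfare n w v f A =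
        ((∑ i ∈ S, w i * (f (v i (A i))).toReal : ℝ) : EReal) := by
      rw [RWelfare, hSA]; exact eA
    have eB' : RWelfare n w v f B =
        ((∑ i ∈ S, w i * (f (v i (B i))).toReal : ℝ) : EReal) := by
      rw [RWelfare, hSB]; exact eB
    have hle := (hA.2.2 hc B hB).2 (hSB.trans hSA.symm)
    refine ⟨?_, fun heq => ⟨hB, fun hc' => ?_, fun _ C hC => ⟨?_, ?_⟩⟩⟩
    · rw [eA', eB'] at hle
      exact EReal.coe_le_coe_iff.1 hle
    · obtain ⟨C, hC, hC'⟩ := hc'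
      exact absurd (hc C hC) hC'
    · rw [hSB, ← hSA]
      exact (hA.2.2 hc C hC).1
    · intro h
      rw [eB', heq, ← eA']
      exact (hA.2.2 hc C hC).2 (h.trans (hSB.trans hSA.symm))

/-- marginal gain -/
noncomputable def marg (w : Fin n → ℝ) (f : ℕ → EReal) (i : Fin n) (s : ℕ) : ℝ :=
  w i * ((f (s + 1)).toReal - (f s).toReal)

/-- priority -/
def Better (w : Fin n → ℝ) (f : ℕ → EReal) (i : Fin n) (s : ℕ) (j : Fin n) (t : ℕ) : Prop :=
  (f s = ⊥ ∧ f t ≠ ⊥) ∨ (f s = ⊥ ∧ f t = ⊥ ∧ i < j) ∨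
    (f s ≠ ⊥ ∧ f t ≠ ⊥ ∧ (marg w f j t < marg w f i s ∨ (marg w f j t = marg w f i s ∧ i < j)))

lemma marg_pos (hw : ∀ i, 0 < w i) (hf : StrictMono f) (hftop : ∀ k, f k ≠ ⊤) (i : Fin n) {s : ℕ}
    (hs : f s ≠ ⊥) : 0 < marg w f i s := by
  have h := hf (Nat.lt_succ_self s)
  rw [← EReal.coe_toReal (hftop s) hs,
    ← EReal.coe_toReal (hftop (s.succ)) (f_fin hf (by omega)), EReal.coe_lt_coe_iff] at h
  exact mul_pos (hw i) (by simpa using sub_pos.2 h)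

lemma marg_anti (hw : ∀ i, 0 < w i) (hf : StrictMono f) (hftop : ∀ k, f k ≠ ⊤)
    (hconc : ∀ k : ℕ, f (k + 2) + f k ≤ f (k + 1) + f (k + 1)) (i : Fin n) {s t : ℕ}
    (hs : f s ≠ ⊥) (hst : s ≤ t) : marg w f i t ≤ marg w f i s := by
  induction t, hst using Nat.le_induction with
  | base => exact le_refl _
  | succ t hst ih =>
    refine le_trans ?_ ih
    have ht : f t ≠ ⊥ := fun e => by
      have := hf.monotone hst
      rw [e, le_bot_iff] at this
      exact hs this
    have h := hconc t
    rw [← EReal.coe_toReal (hftop t) ht,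
      ← EReal.coe_toReal (hftop (t + 1)) (f_fin hf (by omega)),
      ← EReal.coe_toReal (hftop (t + 2)) (f_fin hf (by omega)), ← EReal.coe_add, ← EReal.coe_add,
      EReal.coe_le_coe_iff] at h
    refine mul_le_mul_of_nonneg_left ?_ (hw i).le
    have e : t + 1 + 1 = t + 2 := rfl
    rw [e]
    linarith

lemma better_absurd (hw : ∀ i, 0 < w i) (hf : StrictMono f) (hftop : ∀ k, f k ≠ ⊤)
    (hconc : ∀ k : ℕ, f (k + 2) + f k ≤ f (k + 1) + f (k + 1)) {j k : Fin n} {s s' t t' : ℕ}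
    (hs : s ≤ s') (ht : t ≤ t') (h1 : Better w f k t' j s) (h2 : Better w f j s' k t) : False := by
  have b1 : f s' = ⊥ → f s = ⊥ := fun e => le_bot_iff.1 (e ▸ hf.monotone hs)
  have b2 : f t' = ⊥ → f t = ⊥ := fun e => le_bot_iff.1 (e ▸ hf.monotone ht)
  have m1 := fun h => marg_anti (w := w) hw hf hftop hconc j (s := s) h hs
  have m2 := fun h => marg_anti (w := w) hw hf hftop hconc k (s := t) h ht
  rcases h1 with ⟨p1, q1⟩ | ⟨p1, q1, r1⟩ | ⟨p1, q1, r1⟩ <;>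
  rcases h2 with ⟨p2, q2⟩ | ⟨p2, q2, r2⟩ | ⟨p2, q2, r2⟩
  · exact q1 (b1 p2)
  · exact q1 (b1 p2)
  · exact q2 (b2 p1)
  · exact q2 (b2 p1)
  · exact absurd r1 (not_lt.2 r2.le)
  · exact q2 (b2 p1)
  · exact q1 (b1 p2)
  · exact q1 (b1 p2)
  · have m1 := m1 q1
    have m2 := m2 q2
    rcases r1 with r1 | ⟨r1, r1'⟩ <;> rcases r2 with r2 | ⟨r2, r2'⟩
    · linarith
    · linarith
    · linarith
    · exact absurd r1' (not_lt.2 r2'.le)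

lemma no_improve (hw : ∀ i, 0 < w i) (hf : StrictMono f) (hftop : ∀ k, f k ≠ ⊤)
    {A B : Fin n → Finset γ} (hA : IsRf n M w v f A) (hB : IsAlloc n M B) {j : Fin n}
    (hj : v j (B j) = v j (A j) + 1) (hl : ∀ l, l ≠ j → v l (B l) = v l (A l)) : False := by
  classical
  by_cases hfj : f (v j (A j)) = ⊥
  · have h0 : f 0 = ⊥ := le_bot_iff.1 (hfj ▸ hf.monotone (Nat.zero_le _))
    have ha : v j (A j) = 0 := by
      by_contra h
      exact f_fin hf (Nat.pos_of_ne_zero h) hfj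
    have hP : PosAgents n v B = insert j (PosAgents n v A) := by
      ext i
      by_cases hi : i = j
      · subst hi; simp [PosAgents, hj]
      · simp [PosAgents, hi, hl i hi]
    have := opt_pos hw hf hftop h0 hA hB
    rw [hP, card_insert_of_notMem (by simp [PosAgents, ha])] at this
    omega
  · have hfin : ∀ i, f (v i (A i)) ≠ ⊥ ↔ f (v i (B i)) ≠ ⊥ := by
      intro i
      by_cases hi : i = j
      · subst hi
        exact ⟨fun _ => f_fin hf (by omega), fun _ => hfj⟩
      · rw [hl i hi]
    have h := (opt_core hw hf hftop hA hB hfin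
      (univ.filter fun i => f (v i (A i)) ≠ ⊥) (by simp)).1
    refine absurd h (not_le.2 (sum_lt_sum ?_ ⟨j, by simpa using hfj, ?_⟩))
    · intro i _
      by_cases hi : i = j
      · subst hi
        have := marg_pos hw hf hftop i hfj
        rw [marg] at this
        rw [hj]; linarith
      · rw [hl i hi]
    · have := marg_pos hw hf hftop j hfj
      rw [marg] at this
      rw [hj]; linarith

lemma swap_better (hw : ∀ i, 0 < w i) (hf : StrictMono f) (hftop : ∀ k, f k ≠ ⊤)
    {A B : Fin n → Finset γ} (hA : IsRfTie n M w v f A) (hB : IsAlloc n M B) {j k : Fin n}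
    (hjk : k ≠ j)
    (hj : v j (B j) = v j (A j) + 1) (hk : v k (B k) + 1 = v k (A k))
    (hl : ∀ l, l ≠ j → l ≠ k → v l (B l) = v l (A l)) :
    Better w f k (v k (A k) - 1) j (v j (A j)) := by
  classical
  have ebk : v k (A k) - 1 = v k (B k) := by omega
  rw [ebk]
  have hb0 : ∀ s, f s = ⊥ → f 0 = ⊥ ∧ s = 0 := fun s hs =>
    ⟨le_bot_iff.1 (hs ▸ hf.monotone (Nat.zero_le _)), by
      by_contra h
      exact f_fin hf (Nat.pos_of_ne_zero h) hs⟩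
  by_cases hfk : f (v k (B k)) = ⊥
  · by_cases hfj : f (v j (A j)) = ⊥
    · refine Or.inr (Or.inl ⟨hfk, hfj, ?_⟩)
      obtain ⟨h0, hk0⟩ := hb0 _ hfk
      obtain ⟨-, hj0⟩ := hb0 _ hfj
      have mA : ∀ i, i ∈ PosAgents n v A ↔ 0 < v i (A i) := by intro i; simp [PosAgents]
      have mB : ∀ i, i ∈ PosAgents n v B ↔ 0 < v i (B i) := by intro i; simp [PosAgents]
      have hjA : j ∉ PosAgents n v A := by rw [mA]; omega
      have hjB : j ∈ PosAgents n v B := by rw [mB]; omega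
      have hkA : k ∈ PosAgents n v A := by rw [mA]; omega
      have hkB : k ∉ PosAgents n v B := by rw [mB]; omega
      have hP : PosAgents n v B = insert j ((PosAgents n v A).erase k) := by
        ext i
        rw [mem_insert, mem_erase]
        by_cases hi : i = j
        · subst hi; simp [hjB]
        · by_cases hi' : i = k
          · subst hi'; simp [hkB, hi]
          · rw [mA, mB, hl i hi hi']; simp [hi, hi']
      have hcard : (PosAgents n v B).card = (PosAgents n v A).card := by
        rw [hP, card_insert_of_notMem (by simp [hjA]), card_erase_add_one hkA]
      rcases opt_pos hw hf hftop h0 hA.1 hB with h | ⟨-, h | ⟨i, hiA, hiB, hlt⟩⟩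
      · omega
      · rw [h] at hjA; exact absurd hjB hjA
      · have hik : i = k := by
          by_contra hne
          have hij : i ≠ j := fun e => hjA (e ▸ hiA)
          rw [mB, hl i hij hne, ← mA] at hiB
          exact hiB hiA
        subst hik
        rcases lt_trichotomy i j with h | h | h
        · exact h
        · exact absurd h hjk
        · exact absurd ((hlt j h).2 hjB) hjA
    · exact Or.inl ⟨hfk, hfj⟩
  · by_cases hfj : f (v j (A j)) = ⊥
    · exfalso
      obtain ⟨h0, hj0⟩ := hb0 _ hfj
      have hkp := (f_fin_iff hf h0 _).1 hfk
      have hP : PosAgents n v B = insert j (PosAgents n v A) := by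
        ext i
        by_cases hi : i = j
        · subst hi; simp [PosAgents, hj]
        · by_cases hi' : i = k
          · subst hi'; simp [PosAgents, hi]; omega
          · simp [PosAgents, hi, hl i hi hi']
      have := opt_pos hw hf hftop h0 hA.1 hB
      rw [hP, card_insert_of_notMem (by simp [PosAgents, hj0])] at this
      omega
    · refine Or.inr (Or.inr ⟨hfk, hfj, ?_⟩)
      have hfin : ∀ i, f (v i (A i)) ≠ ⊥ ↔ f (v i (B i)) ≠ ⊥ := by
        intro i
        by_cases hi : i = j
        · subst hi
          exact ⟨fun _ => f_fin hf (by omega), fun _ => hfj⟩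
        · by_cases hi' : i = k
          · subst hi'
            exact ⟨fun _ => hfk, fun _ => f_fin hf (by omega)⟩
          · rw [hl i hi hi']
      set S := univ.filter fun i => f (v i (A i)) ≠ ⊥ with hS
      obtain ⟨h1, h2⟩ := opt_core hw hf hftop hA.1 hB hfin S (by simp [hS])
      have hjS : j ∈ S := by simpa [hS] using hfj
      have hkS : k ∈ S := by
        simp only [hS, mem_filter, mem_univ, true_and]; exact f_fin hf (by omega)
      have hdiff : ∑ i ∈ S, w i * (f (v i (B i))).toReal - ∑ i ∈ S, w i * (f (v i (A i))).toReal
          = marg w f j (v j (A j)) - marg w f k (v k (B k)) := by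
        rw [← sum_sub_distrib, Finset.sum_eq_add_of_mem j k hjS hkS hjk.symm]
        · rw [hj, ← hk, marg, marg]; ring
        · intro c _ hc
          rw [hl c hc.1 hc.2]; ring
      rcases lt_or_eq_of_le h1 with h | h
      · left; linarith
      · right
        refine ⟨by linarith, ?_⟩
        have hnl := hA.2.1 B (h2 h)
        rcases lt_trichotomy k j with h' | h' | h'
        · exact h'
        · exact absurd h' hjk
        · refine absurd ⟨j, ?_, ?_⟩ hnl
          · simp only [hj]; omega
          · intro i hi
            exact (hl i hi.ne (hi.trans h').ne).symm

end welfare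

end RM

/-- Resource-monotonicity of `R^tie_f` for a strictly increasing concave `f` under
matroid-rank valuations: adding a good never decreases any agent's utility. -/
theorem resourceMonotonicity {γ : Type} [DecidableEq γ] {n : ℕ} (M : Finset γ)
    (gstar : γ) (hg : gstar ∉ M)
    (w : Fin n → ℝ) (hw : ∀ i, 0 < w i)
    (v : Fin n → Finset γ → ℕ) (hv : ∀ i, MatroidRank (insert gstar M) (v i))
    (f : ℕ → EReal) (hf : StrictMono f) (hftop : ∀ k, f k ≠ ⊤)
    (hconc : ∀ k : ℕ, f (k + 2) + f k ≤ f (k + 1) + f (k + 1))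
    (A A' : Fin n → Finset γ)
    (hA : IsRfTie n M w v f A) (hA' : IsRfTie n (insert gstar M) w v f A') :
    ∀ i : Fin n, v i (A i) ≤ v i (A' i) := by

  have hcA : RM.Clean n M v A := ⟨hA.1.1, hA.2.2⟩
  have hcA' : RM.Clean n (insert gstar M) v A' := ⟨hA'.1.1, hA'.2.2⟩
  intro j
  by_contra hlt
  push Not at hlt
  have hj : (A' j).card < (A j).card := by rw [← hcA.2 j, ← hcA'.2 j]; exact hlt
  rcases RM.sim_exchange hg hv hcA hcA' hj with
    ⟨B, hB, h1, h2⟩ | ⟨k, hkj, hk, ⟨B', hB', p1, p2, p3⟩, ⟨B, hB, q1, q2, q3⟩⟩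
  · refine RM.no_improve hw hf hftop hA'.1 hB.1 (j := j) ?_ ?_
    · rw [hB.2, hcA'.2, h1]
    · intro l hl; rw [hB.2, hcA'.2, h2 l hl]
  · have b1 := RM.swap_better hw hf hftop hA' hB'.1 hkj (by rw [hB'.2, hcA'.2, p1])
      (by rw [hB'.2, hcA'.2, p2]) (fun l h1 h2 => by rw [hB'.2, hcA'.2, p3 l h1 h2])
    have b2 := RM.swap_better hw hf hftop hA hB.1 hkj.symm (by rw [hB.2, hcA.2, q1])
      (by rw [hB.2, hcA.2, q2]) (fun l h1 h2 => by rw [hB.2, hcA.2, q3 l h1 h2])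
    rw [hcA'.2, hcA'.2] at b1
    rw [hcA.2, hcA.2] at b2
    exact RM.better_absurd hw hf hftop hconc (by omega) (by omega) b1 b2
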